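/- arXiv:2311.02544 — 2 statements merged into one kernel-verified Lean document; each statement's English description precedes it below -/
import Mathlib

section
/- Let ε > 0 and δ > 0 satisfy: for all x, y : Fin d → ℝ, if ‖x − y‖₁ < δ then |W(x) − W(y)| < ε. Set α = δ/d. Then for every state s ∈ S, every vector v : Fin d → ℝ, and every t with 0 ≤ t ≤ T, the RAVI value function satisfies V_α(s, v, t) ≥ V*(s, v, t) − t·ε. -/
/-- The L1 norm on `Fin d → ℝ`: `‖x‖₁ = ∑ i, |x i|`. -/
noncomputable def l1norm {d : ℕ} (x : Fin d → ℝ) : ℝ := ∑ i, |x i|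

/-- The discretization map `f_α(x) i = ⌊x i / α⌋·α`. -/
noncomputable def falpha {d : ℕ} (α : ℝ) (x : Fin d → ℝ) : Fin d → ℝ :=
  fun i => (⌊x i / α⌋ : ℝ) * α

/-- The optimal value function `V*` of an MOMDP, defined by backward recursion on the
number `t` of remaining steps. -/
noncomputable def Vstar {S A : Type} [Fintype S] [Fintype A] [Nonempty A] {d : ℕ}
    (P : S → A → S → ℝ) (R : S → A → Fin d → ℝ) (γ : ℝ) (T : ℕ)
    (W : (Fin d → ℝ) → ℝ) : ℕ → S → (Fin d → ℝ) → ℝ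
  | 0, _, v => W v
  | t + 1, s, v => Finset.univ.sup' Finset.univ_nonempty fun a : A =>
      ∑ s' : S, P s a s' * Vstar P R γ T W t s' (v + γ ^ (T - (t + 1)) • R s a)

/-- The RAVI value function `V_α`, defined like `V*` but with the accumulated reward
discretized by `f_α` at each step:  `V_α(s, v, 0) = W v` and, for `t ≥ 1`,
`V_α(s, v, t) = max_a ∑_{s'} P s a s' · V_α(s', f_α(v + γ^{T−t} • R s a), t−1)`. -/
noncomputable def Vravi {S A : Type} [Fintype S] [Fintype A] [Nonempty A] {d : ℕ}
    (P : S → A → S → ℝ) (R : S → A → Fin d → ℝ) (γ : ℝ) (T : ℕ)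
    (W : (Fin d → ℝ) → ℝ) (α : ℝ) : ℕ → S → (Fin d → ℝ) → ℝ
  | 0, _, v => W v
  | t + 1, s, v => Finset.univ.sup' Finset.univ_nonempty fun a : A =>
      ∑ s' : S, P s a s' *
        Vravi P R γ T W α t s' (falpha α (v + γ ^ (T - (t + 1)) • R s a))

theorem sup'_sum_mul_le_add {S A : Type} [Fintype S] [Fintype A] [Nonempty A]
    {p : A → S → ℝ} (hp0 : ∀ a s, 0 ≤ p a s) (hp1 : ∀ a, ∑ s, p a s = 1)
    {f g : A → S → ℝ} {c : ℝ} (h : ∀ a s, f a s ≤ g a s + c) :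
    (Finset.univ.sup' Finset.univ_nonempty fun a => ∑ s, p a s * f a s) ≤
      (Finset.univ.sup' Finset.univ_nonempty fun a => ∑ s, p a s * g a s) + c := by
  refine Finset.sup'_le _ _ fun a _ => ?_
  calc ∑ s, p a s * f a s ≤ ∑ s, p a s * (g a s + c) :=
        Finset.sum_le_sum fun s _ => mul_le_mul_of_nonneg_left (h a s) (hp0 a s)
    _ = ∑ s, p a s * g a s + c := by
        simp only [mul_add, Finset.sum_add_distrib, ← Finset.sum_mul, hp1, one_mul]
    _ ≤ _ := by
        gcongr
        exact Finset.le_sup' (fun a => ∑ s, p a s * g a s) (Finset.mem_univ a)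

theorem l1norm_sub_falpha_lt {d : ℕ} (hd : 1 ≤ d) {α : ℝ} (hα : 0 < α) (x : Fin d → ℝ) :
    l1norm (x - falpha α x) < d * α := by
  have : Nonempty (Fin d) := ⟨⟨0, hd⟩⟩
  have key : ∀ i, |(x - falpha α x) i| < α := fun i => by
    have hfract : (x - falpha α x) i = Int.fract (x i / α) * α := by
      simp only [Pi.sub_apply, falpha, Int.fract, sub_mul, div_mul_cancel₀ _ hα.ne']
    rw [hfract, abs_of_nonneg (mul_nonneg (Int.fract_nonneg _) hα.le)]
    exact mul_lt_of_lt_one_left hα (Int.fract_lt_one _)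
  calc l1norm (x - falpha α x) < ∑ _i : Fin d, α :=
        Finset.sum_lt_sum_of_nonempty Finset.univ_nonempty fun i _ => key i
    _ = d * α := by simp

theorem Vstar_le_add {S A : Type} [Fintype S] [Fintype A] [Nonempty A] {d : ℕ}
    {P : S → A → S → ℝ} (hP0 : ∀ s a s', 0 ≤ P s a s') (hP1 : ∀ s a, ∑ s', P s a s' = 1)
    (R : S → A → Fin d → ℝ) (γ : ℝ) (T : ℕ) {W : (Fin d → ℝ) → ℝ} {ε δ : ℝ}
    (hW : ∀ x y : Fin d → ℝ, l1norm (x - y) < δ → W x ≤ W y + ε)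
    (t : ℕ) (s : S) (x y : Fin d → ℝ) (hxy : l1norm (x - y) < δ) :
    Vstar P R γ T W t s x ≤ Vstar P R γ T W t s y + ε := by
  induction t generalizing s x y with
  | zero => exact hW x y hxy
  | succ t ih =>
    refine sup'_sum_mul_le_add (hP0 s) (hP1 s) fun a s' => ih _ _ _ ?_
    rwa [add_sub_add_right_eq_sub]

/-- approximation error of RAVI.  If `|W x − W y| < ε` whenever
`‖x − y‖₁ < δ`, and `α = δ/d`, then for every state `s`, vector `v`, and `t ≤ T`,
`V_α(s, v, t) ≥ V*(s, v, t) − t·ε`. -/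
theorem ravi_error {S A : Type} [Fintype S] [Fintype A] [Nonempty S] [Nonempty A]
    {d : ℕ} (hd : 1 ≤ d)
    (P : S → A → S → ℝ) (hP0 : ∀ s a s', 0 ≤ P s a s') (hP1 : ∀ s a, ∑ s', P s a s' = 1)
    (R : S → A → Fin d → ℝ) (hR0 : ∀ s a i, 0 ≤ R s a i) (hR1 : ∀ s a i, R s a i ≤ 1)
    (γ : ℝ) (hγ0 : 0 ≤ γ) (hγ1 : γ < 1) (T : ℕ) (W : (Fin d → ℝ) → ℝ)
    (ε δ : ℝ) (hε : 0 < ε) (hδ : 0 < δ)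
    (hW : ∀ x y : Fin d → ℝ, l1norm (x - y) < δ → |W x - W y| < ε)
    (α : ℝ) (hα : α = δ / d)
    (s : S) (v : Fin d → ℝ) (t : ℕ) (ht : t ≤ T) :
    Vravi P R γ T W α t s v ≥ Vstar P R γ T W t s v - t * ε := by
  have hd0 : (0 : ℝ) < d := by exact_mod_cast hd
  have hα0 : 0 < α := hα ▸ div_pos hδ hd0
  have hdα : d * α = δ := by rw [hα, mul_div_cancel₀ _ hd0.ne']
  have hW' : ∀ x y : Fin d → ℝ, l1norm (x - y) < δ → W x ≤ W y + ε := fun x y hxy => by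
    linarith [(abs_lt.mp (hW x y hxy)).2]
  clear ht
  suffices h : Vstar P R γ T W t s v ≤ Vravi P R γ T W α t s v + t * ε by linarith
  induction t generalizing s v with
  | zero => simp [Vstar, Vravi]
  | succ t ih =>
    refine sup'_sum_mul_le_add (hP0 s) (hP1 s) fun a s' => ?_
    have hstar := Vstar_le_add hP0 hP1 R γ T hW' t s' _ _
      ((l1norm_sub_falpha_lt hd hα0 (v + γ ^ (T - (t + 1)) • R s a)).trans_eq hdα)
    have hravi := ih s' (falpha α (v + γ ^ (T - (t + 1)) • R s a))
    push_cast
    linarith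
end

section
/- Let β ≥ 0, let π be any history-dependent policy, let s ∈ S, and let T ≥ 1. Call a length-T trajectory τ = ((s₁,a₁),…,(s_T,a_T)) β-bad if there exists k with 1 ≤ k ≤ T−1 such that P s_k a_k s_{k+1} ≤ β. Then ∑_{τ β-bad, s₁ = s} Pr^π[τ] ≤ β·|S|·|A|·T. -/
/-- The probability `Pr^π[τ]` of a trajectory `τ` (a list of state-action pairs),
executed after history `h` with `t` steps remaining at the start of `τ`, under
history-dependent policy `pol` in an MDP with transition function `P`. -/
noncomputable def PrTraj {S A : Type}
    (P : S → A → S → ℝ) (pol : List (S × A) → S → ℕ → A → ℝ) :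
    List (S × A) → ℕ → List (S × A) → ℝ
  | _, _, [] => 1
  | h, t, (s, a) :: rest =>
      pol h s t a *
      (match rest with
       | [] => 1
       | (s', _) :: _ => P s a s') *
      PrTraj P pol (h ++ [(s, a)]) (t - 1) rest

open Classical in
/-- The expectation of `F` over trajectories of length `n + 1` started at `s` after history `h`
with `t` steps remaining. -/
noncomputable def trajExpectation {S A : Type} [Fintype S] [Fintype A]
    (P : S → A → S → ℝ) (pol : List (S × A) → S → ℕ → A → ℝ) (n : ℕ)
    (h : List (S × A)) (t : ℕ) (s : S) (F : (Fin (n + 1) → S × A) → ℝ) : ℝ :=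
  ∑ τ : Fin (n + 1) → S × A, if (τ 0).1 = s then F τ * PrTraj P pol h t (List.ofFn τ) else 0

/-- Some transition along `τ` is `β`-small. -/
def HasSmallTransition {S A : Type} (P : S → A → S → ℝ) (β : ℝ) {T : ℕ}
    (τ : Fin T → S × A) : Prop :=
  ∃ (k : Fin T) (hk : (k : ℕ) + 1 < T), P (τ k).1 (τ k).2 (τ ⟨(k : ℕ) + 1, hk⟩).1 ≤ β

section

variable {S A : Type} {P : S → A → S → ℝ} {pol : List (S × A) → S → ℕ → A → ℝ} {β : ℝ}

lemma prTraj_ofFn_cons (n : ℕ) (h : List (S × A)) (t : ℕ) (x : S × A)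
    (τ : Fin (n + 1) → S × A) :
    PrTraj P pol h t (List.ofFn (Fin.cons x τ : Fin (n + 2) → S × A)) =
      pol h x.1 t x.2 * P x.1 x.2 (τ 0).1 * PrTraj P pol (h ++ [x]) (t - 1) (List.ofFn τ) := by
  rw [List.ofFn_succ]
  simp only [Fin.cons_zero, Fin.cons_succ]
  rw [List.ofFn_succ, PrTraj]

lemma prTraj_nonneg (hP0 : ∀ s a s', 0 ≤ P s a s') (hpol0 : ∀ h s t a, 0 ≤ pol h s t a)
    (l : List (S × A)) (h : List (S × A)) (t : ℕ) : 0 ≤ PrTraj P pol h t l := by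
  induction l generalizing h t with
  | nil => simp [PrTraj]
  | cons x l ih =>
    cases l with
    | nil =>
      rw [PrTraj]
      exact mul_nonneg (mul_nonneg (hpol0 _ _ _ _) zero_le_one) (ih _ _)
    | cons y l =>
      rw [PrTraj]
      exact mul_nonneg (mul_nonneg (hpol0 _ _ _ _) (hP0 _ _ _)) (ih _ _)

lemma HasSmallTransition.of_cons {n : ℕ} {x : S × A} {τ : Fin (n + 1) → S × A}
    (hτ : HasSmallTransition P β (Fin.cons x τ : Fin (n + 2) → S × A)) :
    P x.1 x.2 (τ 0).1 ≤ β ∨ HasSmallTransition P β τ := by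
  obtain ⟨k, hk, hle⟩ := hτ
  induction k using Fin.cases with
  | zero => exact Or.inl hle
  | succ k => exact Or.inr ⟨k, by simpa using hk, hle⟩

lemma not_hasSmallTransition_of_length_one (τ : Fin 1 → S × A) : ¬ HasSmallTransition P β τ := by
  rintro ⟨k, hk, -⟩
  omega

variable [Fintype S] [Fintype A]

lemma trajExpectation_zero_one (hpol1 : ∀ h s t, ∑ a, pol h s t a = 1)
    (h : List (S × A)) (t : ℕ) (s : S) :
    trajExpectation P pol 0 h t s (fun _ => 1) = 1 := by
  classical
  unfold trajExpectation
  rw [← (Equiv.funUnique (Fin 1) (S × A)).symm.sum_comp, Fintype.sum_prod_type]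
  simp [PrTraj, Finset.sum_ite_irrel, hpol1]

lemma trajExpectation_succ (n : ℕ) (h : List (S × A)) (t : ℕ) (s : S)
    (F : (Fin (n + 2) → S × A) → ℝ) :
    trajExpectation P pol (n + 1) h t s F =
      ∑ a, pol h s t a * ∑ s', P s a s' *
        trajExpectation P pol n (h ++ [(s, a)]) (t - 1) s' (fun τ => F (Fin.cons (s, a) τ)) := by
  classical
  unfold trajExpectation
  rw [← (Fin.consEquiv (fun _ : Fin (n + 2) => S × A)).sum_comp, Fintype.sum_prod_type,
    Fintype.sum_prod_type, Finset.sum_eq_single s (fun b _ hb => by simp [hb]) (by simp)]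
  refine Finset.sum_congr rfl fun a _ => ?_
  simp_rw [Finset.mul_sum]
  rw [Finset.sum_comm]
  refine Finset.sum_congr rfl fun τ _ => ?_
  change (if s = s then F (Fin.cons (s, a) τ) *
    PrTraj P pol h t (List.ofFn (Fin.cons (s, a) τ : Fin (n + 2) → S × A)) else 0) = _
  rw [if_pos rfl, prTraj_ofFn_cons]
  simp only [mul_ite, mul_zero, Finset.sum_ite_eq, Finset.mem_univ, if_true]
  ring

lemma trajExpectation_one (hP1 : ∀ s a, ∑ s', P s a s' = 1)
    (hpol1 : ∀ h s t, ∑ a, pol h s t a = 1) (n : ℕ) (h : List (S × A)) (t : ℕ) (s : S) :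
    trajExpectation P pol n h t s (fun _ => 1) = 1 := by
  induction n generalizing h t s with
  | zero => exact trajExpectation_zero_one hpol1 h t s
  | succ n ih => simp [trajExpectation_succ, ih, hP1, hpol1]

lemma trajExpectation_le_add (hP0 : ∀ s a s', 0 ≤ P s a s')
    (hpol0 : ∀ h s t a, 0 ≤ pol h s t a) (n : ℕ) (h : List (S × A)) (t : ℕ) (s : S) (c : ℝ)
    (F G : (Fin (n + 1) → S × A) → ℝ) (hFG : ∀ τ, (τ 0).1 = s → F τ ≤ c + G τ) :
    trajExpectation P pol n h t s F ≤
      c * trajExpectation P pol n h t s (fun _ => 1) + trajExpectation P pol n h t s G := by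
  unfold trajExpectation
  rw [Finset.mul_sum, ← Finset.sum_add_distrib]
  refine Finset.sum_le_sum fun τ _ => ?_
  split_ifs with hs
  · have := mul_le_mul_of_nonneg_right (hFG τ hs)
      (prTraj_nonneg hP0 hpol0 (List.ofFn τ) h t)
    linarith
  · simp

open Classical in
/-- The union bound over the `n` transitions of a trajectory of length `n + 1`. -/
lemma trajExpectation_hasSmallTransition_le (hP0 : ∀ s a s', 0 ≤ P s a s')
    (hP1 : ∀ s a, ∑ s', P s a s' = 1) (hpol0 : ∀ h s t a, 0 ≤ pol h s t a)
    (hpol1 : ∀ h s t, ∑ a, pol h s t a = 1) (hβ : 0 ≤ β)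
    (n : ℕ) (h : List (S × A)) (t : ℕ) (s : S) :
    trajExpectation P pol n h t s (fun τ => if HasSmallTransition P β τ then 1 else 0) ≤
      β * Fintype.card S * n := by
  induction n generalizing h t s with
  | zero => simp [trajExpectation, not_hasSmallTransition_of_length_one]
  | succ n ih =>
    rw [trajExpectation_succ]
    calc _ ≤ ∑ a, pol h s t a * ∑ s', (β + P s a s' * (β * Fintype.card S * n)) := by
          refine Finset.sum_le_sum fun a _ => mul_le_mul_of_nonneg_left
            (Finset.sum_le_sum fun s' _ => ?_) (hpol0 _ _ _ _)
          have hstep := trajExpectation_le_add hP0 hpol0 n (h ++ [(s, a)]) (t - 1) s'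
            (if P s a s' ≤ β then 1 else 0)
            (fun τ => if HasSmallTransition P β (Fin.cons (s, a) τ : Fin (n + 2) → S × A)
              then 1 else 0)
            (fun τ => if HasSmallTransition P β τ then 1 else 0) (by
              intro τ hτ
              have hor : HasSmallTransition P β (Fin.cons (s, a) τ : Fin (n + 2) → S × A) →
                  P s a s' ≤ β ∨ HasSmallTransition P β τ := by
                rw [← hτ]
                exact HasSmallTransition.of_cons
              split_ifs <;> first | (exfalso; tauto) | norm_num)
          rw [trajExpectation_one hP1 hpol1, mul_one] at hstep
          refine (mul_le_mul_of_nonneg_left (hstep.trans (add_le_add_right (ih _ _ _) _))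
            (hP0 s a s')).trans ?_
          rw [mul_add]
          refine add_le_add_left ?_ _
          split_ifs with hsmall
          · simpa using hsmall
          · simpa using hβ
      _ = β * Fintype.card S * (n + 1 : ℕ) := by
          simp only [Finset.sum_add_distrib, ← Finset.sum_mul, hP1, hpol1, Finset.sum_const,
            Finset.card_univ, nsmul_eq_mul]
          push_cast
          ring

end

open Classical in
/-- β-small transitions.  Call a length-`T` trajectory
`τ = ((s₁,a₁),…,(s_T,a_T))` `β`-bad if `P s_k a_k s_{k+1} ≤ β` for some `1 ≤ k ≤ T−1`.
Then the total probability of `β`-bad trajectories starting at `s` is at most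
`β·|S|·|A|·T`. -/
theorem beta_small_transition_bound {S A : Type} [Fintype S] [Fintype A]
    [Nonempty S] [Nonempty A] {d : ℕ} (hd : 1 ≤ d)
    (P : S → A → S → ℝ) (hP0 : ∀ s a s', 0 ≤ P s a s') (hP1 : ∀ s a, ∑ s', P s a s' = 1)
    (R : S → A → Fin d → ℝ) (hR0 : ∀ s a i, 0 ≤ R s a i) (hR1 : ∀ s a i, R s a i ≤ 1)
    (γ : ℝ) (hγ0 : 0 ≤ γ) (hγ1 : γ < 1)
    (pol : List (S × A) → S → ℕ → A → ℝ)
    (hpol0 : ∀ h s t a, 0 ≤ pol h s t a)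
    (hpol1 : ∀ h s t, ∑ a, pol h s t a = 1)
    (β : ℝ) (hβ : 0 ≤ β) (s : S) (T : ℕ) (hT : 1 ≤ T) :
    ∑ τ : Fin T → S × A,
      (if (τ ⟨0, hT⟩).1 = s ∧
          (∃ (k : Fin T) (hk : (k : ℕ) + 1 < T),
            P (τ k).1 (τ k).2 (τ ⟨(k : ℕ) + 1, hk⟩).1 ≤ β)
        then PrTraj P pol [] T (List.ofFn τ) else 0)
      ≤ β * (Fintype.card S) * (Fintype.card A) * T := by
  obtain ⟨n, rfl⟩ : ∃ n, T = n + 1 := ⟨T - 1, by omega⟩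
  have hbound := trajExpectation_hasSmallTransition_le hP0 hP1 hpol0 hpol1 hβ n [] (n + 1) s
  have hA : (1 : ℝ) ≤ Fintype.card A := by exact_mod_cast Fintype.card_pos
  calc _ = _ := by
        refine Finset.sum_congr rfl fun τ _ => ?_
        rw [ite_and]
        refine if_congr Iff.rfl ?_ rfl
        rw [ite_mul, one_mul, zero_mul]
        exact if_congr Iff.rfl rfl rfl
    _ ≤ _ := hbound
    _ ≤ β * Fintype.card S * Fintype.card A * (n + 1 : ℕ) := by
        have hS := mul_nonneg hβ (Nat.cast_nonneg (α := ℝ) (Fintype.card S))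
        exact mul_le_mul (le_mul_of_one_le_right hS hA) (by exact_mod_cast n.le_succ)
          n.cast_nonneg (by positivity)
end
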